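/- Let V₁ and V₂ be two disjoint nonempty vertex sets of a graph G. Then VEL(Γ*(V₁,V₂)) = VEL(Γ(V₁,V₂))⁻¹, where Γ(V₁,V₂) is the family of vertex paths connecting V₁ to V₂ and Γ*(V₁,V₂) is the family of vertex sets meeting every path in Γ(V₁,V₂). -/

import Mathlib

open scoped ENNReal

/-- A vertex curve in the graph `G`: a nonempty list of vertices in which
consecutive vertices are adjacent. -/
def IsCurve {V : Type*} (G : SimpleGraph V) (γ : List V) : Prop :=
  γ ≠ [] ∧ γ.Chain' G.Adj

/-- A curve connecting the vertex set `A` to the vertex set `B`. -/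
def ConnectsSets {V : Type*} (G : SimpleGraph V) (A B : Set V) (γ : List V) : Prop :=
  IsCurve G γ ∧ (∃ a ∈ A, γ.head? = some a) ∧ (∃ b ∈ B, γ.getLast? = some b)

/-- The vertex module of a family of vertex curves. -/
noncomputable def MOD {V : Type*} (Γ : Set (List V)) : ℝ≥0∞ :=
  ⨅ m ∈ {m : V → ℝ≥0∞ | ∀ γ ∈ Γ, 1 ≤ (γ.map m).sum}, ∑' v, (m v) ^ 2

/-- The vertex extremal length of a family of vertex curves. -/
noncomputable def VEL {V : Type*} (Γ : Set (List V)) : ℝ≥0∞ := (MOD Γ)⁻¹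

/-- The vertex extremal length between two vertex sets. -/
noncomputable def VELbetween {V : Type*} (G : SimpleGraph V) (A B : Set V) : ℝ≥0∞ :=
  VEL {γ | ConnectsSets G A B γ}

/-- The vertex module of a family of vertex sets (cuts). -/
noncomputable def MODsets {V : Type*} (Γ : Set (Set V)) : ℝ≥0∞ :=
  ⨅ m ∈ {m : V → ℝ≥0∞ | ∀ S ∈ Γ, 1 ≤ ∑' v : S, m v}, ∑' v, (m v) ^ 2

/-- The vertex extremal length of a family of vertex sets. -/
noncomputable def VELsets {V : Type*} (Γ : Set (Set V)) : ℝ≥0∞ := (MODsets Γ)⁻¹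

/-- `Γ*(V₁,V₂)`: the family of vertex sets meeting every curve connecting
`V₁` to `V₂`. -/
def CutFamily {V : Type*} (G : SimpleGraph V) (A B : Set V) : Set (Set V) :=
  {S | ∀ γ, ConnectsSets G A B γ → ∃ v ∈ γ, v ∈ S}

/-- Cauchy-Schwarz for sums in `ℝ≥0∞`, normalised. -/
lemma cs_one {V : Type*} (m n : V → ℝ≥0∞) (h : 1 ≤ ∑' v, m v * n v) :
    1 ≤ (∑' v, m v ^ 2) * (∑' v, n v ^ 2) := by
  have key : ∑' v, m v * n v ≤ (∑' v, m v ^ 2) ^ (1 / 2 : ℝ) * (∑' v, n v ^ 2) ^ (1 / 2 : ℝ) := by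
    rw [ENNReal.tsum_eq_iSup_sum]
    refine iSup_le fun s => ?_
    have hpq : (2 : ℝ).HolderConjugate 2 := Real.HolderConjugate.two_two
    refine (ENNReal.inner_le_Lp_mul_Lq s m n hpq).trans ?_
    simp only [ENNReal.rpow_two]
    gcongr
    · exact ENNReal.sum_le_tsum s
    · exact ENNReal.sum_le_tsum s
  have h2 := h.trans key
  rw [← ENNReal.mul_rpow_of_nonneg _ _ (by norm_num)] at h2
  by_contra hc
  push Not at hc
  have := ENNReal.rpow_lt_one hc (z := (1 / 2 : ℝ)) (by norm_num)
  exact absurd h2 (not_le.mpr this)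

/-- A discrete intermediate value property along a curve. -/
lemma exists_crossing {V : Type*} (G : SimpleGraph V) (m f : V → ℝ≥0∞) (t : ℝ≥0∞)
    (hf : ∀ u v, G.Adj u v → f v ≤ f u + m v) (b : V) (hb : t ≤ f b) :
    ∀ (γ : List V) (a : V), (a :: γ).IsChain G.Adj → f a ≤ t + m a →
      (a :: γ).getLast? = some b → ∃ v ∈ a :: γ, t ≤ f v ∧ f v ≤ t + m v := by
  intro γ
  induction γ with
  | nil =>
    intro a _ h1 h2
    simp at h2
    subst h2
    exact ⟨a, by simp, hb, h1⟩
  | cons c γ ih =>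
    intro a hch h1 h2
    by_cases hta : t ≤ f a
    · exact ⟨a, by simp, hta, h1⟩
    · push Not at hta
      rw [List.isChain_cons_cons] at hch
      have hc : f c ≤ t + m c := (hf a c hch.1).trans (by gcongr)
      obtain ⟨v, hv, hv'⟩ := ih c hch.2 hc (by simpa using h2)
      exact ⟨v, List.mem_cons_of_mem _ hv, hv'⟩

/-- The `m`-distance from the set `A`. -/
noncomputable def dA {V : Type*} (G : SimpleGraph V) (A : Set V) (m : V → ℝ≥0∞) (v : V) : ℝ≥0∞ :=
  ⨅ γ : {γ : List V // ConnectsSets G A {v} γ}, ((γ : List V).map m).sum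

lemma dA_adj {V : Type*} (G : SimpleGraph V) (A : Set V) (m : V → ℝ≥0∞) (u v : V)
    (h : G.Adj u v) : dA G A m v ≤ dA G A m u + m v := by
  unfold dA
  rw [ENNReal.iInf_add]
  refine le_iInf fun γ => ?_
  obtain ⟨γ, ⟨hne, hch⟩, ⟨a, ha, hh⟩, ⟨b, hb, hl⟩⟩ := γ
  simp only [Set.mem_singleton_iff] at hb
  subst hb
  have hc1 : (γ ++ [v]).IsChain G.Adj := by
    refine List.IsChain.append hch (by simp) ?_
    intro x hx y hy
    rw [hl] at hx
    simp only [Option.mem_def, Option.some.injEq, List.head?_cons] at hx hy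
    subst hx; subst hy; exact h
  have hc2 : (γ ++ [v]).head? = some a := by
    cases γ with
    | nil => simp at hh
    | cons c γ => simpa using hh
  refine (iInf_le _ ⟨γ ++ [v], ⟨by simp, hc1⟩, ⟨a, ha, hc2⟩, ⟨v, rfl, by simp⟩⟩).trans ?_
  simp

lemma vol_le {d m : ℝ≥0∞} (hm : m ≠ ⊤) :
    MeasureTheory.volume {t : ℝ | t ∈ Set.Ioo (0:ℝ) 1 ∧ ENNReal.ofReal t ≤ d ∧ d ≤ ENNReal.ofReal t + m} ≤ m := by
  by_cases hd : d = ⊤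
  · have : {t : ℝ | t ∈ Set.Ioo (0:ℝ) 1 ∧ ENNReal.ofReal t ≤ d ∧ d ≤ ENNReal.ofReal t + m} = ∅ := by
      ext t
      simp [hd, hm]
    rw [this]; simp
  · lift d to NNReal using hd
    lift m to NNReal using hm
    calc _ ≤ MeasureTheory.volume (Set.Icc ((d:ℝ) - m) d) := by
          apply MeasureTheory.measure_mono
          rintro t ⟨ht, h1, h2⟩
          have ht0 : 0 ≤ t := ht.1.le
          lift t to NNReal using ht0
          rw [ENNReal.ofReal_coe_nnreal] at h1 h2
          norm_cast at h1 h2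
          have h2' : (d:ℝ) ≤ t + m := by exact_mod_cast h2
          constructor
          · linarith
          · exact_mod_cast h1
      _ = m := by
          rw [Real.volume_Icc]; simp

lemma coarea {V : Type*} (G : SimpleGraph V) (A B : Set V) (m n : V → ℝ≥0∞)
    (hm : ∀ γ, ConnectsSets G A B γ → 1 ≤ (γ.map m).sum)
    (hn : ∀ S ∈ CutFamily G A B, 1 ≤ ∑' v : S, n v)
    (hmf : ∀ v, m v ≠ ⊤) (hc : (Function.support n).Countable) :
    1 ≤ ∑' v, m v * n v := by
  set I : V → Set ℝ := fun v => {t : ℝ | t ∈ Set.Ioo (0:ℝ) 1 ∧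
    ENNReal.ofReal t ≤ dA G A m v ∧ dA G A m v ≤ ENNReal.ofReal t + m v} with hI
  have hImeas : ∀ v, MeasurableSet (I v) := by
    intro v
    have h1 : MeasurableSet {t : ℝ | ENNReal.ofReal t ≤ dA G A m v} :=
      measurableSet_le (by fun_prop) (by fun_prop)
    have h2 : MeasurableSet {t : ℝ | dA G A m v ≤ ENNReal.ofReal t + m v} :=
      measurableSet_le (by fun_prop) (by fun_prop)
    exact measurableSet_Ioo.inter (h1.inter h2)
  have hcount : Countable (Function.support n) := hc
  have hpt : ∀ t ∈ Set.Ioo (0:ℝ) 1,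
      1 ≤ ∑' v : Function.support n, (I v).indicator (fun _ => n v) t := by
    intro t ht
    have hcut : {v | t ∈ I v} ∈ CutFamily G A B := by
      rintro γ ⟨⟨hne, hch⟩, ⟨a, ha, hh⟩, ⟨b, hb, hl⟩⟩
      cases γ with
      | nil => simp at hh
      | cons c γ =>
        simp at hh
        subst hh
        have hdb : ENNReal.ofReal t ≤ dA G A m b := by
          refine le_iInf fun γ' => ?_
          obtain ⟨γ', h1, h2, ⟨b', hb', h3⟩⟩ := γ'
          simp only [Set.mem_singleton_iff] at hb'
          subst hb'
          refine le_trans ?_ (hm γ' ⟨h1, h2, ⟨_, hb, h3⟩⟩)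
          simpa using ht.2.le
        have hdc : dA G A m c ≤ ENNReal.ofReal t + m c := by
          refine (iInf_le _ ⟨[c], ⟨by simp, by simp [List.Chain']⟩, ⟨c, ha, by simp⟩, ⟨c, rfl, by simp⟩⟩).trans ?_
          simp
        obtain ⟨v, hv, hv'⟩ := exists_crossing G m (dA G A m) (ENNReal.ofReal t)
          (fun u v h => dA_adj G A m u v h) b hdb γ c hch hdc hl
        exact ⟨v, hv, ht, hv'⟩
    refine (hn _ hcut).trans (le_of_eq ?_)
    rw [tsum_subtype {v | t ∈ I v} n]
    rw [← tsum_subtype_eq_of_support_subset (s := Function.support n)]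
    · rfl
    · intro v hv
      simp only [Function.mem_support, Set.indicator] at hv ⊢
      split_ifs at hv <;> simp_all
  calc (1 : ℝ≥0∞) = ∫⁻ t in Set.Ioo (0:ℝ) 1, 1 := by simp
    _ ≤ ∫⁻ t in Set.Ioo (0:ℝ) 1, ∑' v : Function.support n, (I v).indicator (fun _ => n v) t :=
        MeasureTheory.setLIntegral_mono' measurableSet_Ioo hpt
    _ ≤ ∫⁻ t, ∑' v : Function.support n, (I v).indicator (fun _ => n v) t :=
        MeasureTheory.setLIntegral_le_lintegral _ _
    _ = ∑' v : Function.support n, ∫⁻ t, (I v).indicator (fun _ => n v) t := by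
        rw [MeasureTheory.lintegral_tsum]
        intro v
        exact (measurable_const.indicator (hImeas v)).aemeasurable
    _ ≤ ∑' v : Function.support n, m v * n v := by
        refine ENNReal.tsum_le_tsum fun v => ?_
        rw [MeasureTheory.lintegral_indicator_const (hImeas v), mul_comm]
        gcongr
        exact vol_le (hmf v)
    _ ≤ ∑' v, m v * n v := ENNReal.tsum_comp_le_tsum_of_injective Subtype.val_injective (fun v => m v * n v)

lemma weak {V : Type*} (G : SimpleGraph V) (A B : Set V) (m n : V → ℝ≥0∞)
    (hm : ∀ γ, ConnectsSets G A B γ → 1 ≤ (γ.map m).sum)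
    (hn : ∀ S ∈ CutFamily G A B, 1 ≤ ∑' v : S, n v) :
    (∑' v, m v ^ 2)⁻¹ ≤ ∑' v, n v ^ 2 := by
  by_cases h1 : ∑' v, m v ^ 2 = ⊤
  · simp [h1]
  by_cases h2 : ∑' v, n v ^ 2 = ⊤
  · simp [h2]
  have hmf : ∀ v, m v ≠ ⊤ := fun v hv => ENNReal.ne_top_of_tsum_ne_top h1 v (by simp [hv])
  have hc : (Function.support n).Countable := by
    have := Summable.countable_support_ennreal h2
    refine this.mono fun v hv => ?_
    simpa using hv
  have := cs_one m n (coarea G A B m n hm hn hmf hc)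
  rw [ENNReal.inv_le_iff_le_mul]
  · exact this
  · intro _ h; simp [h] at this
  · intro h; exact absurd h h1

/-- The multiplicity vector of a list of vertices. -/
noncomputable def multVec {V : Type*} [DecidableEq V] (γ : List V) : lp (fun _ : V => ℝ) 2 :=
  (γ.map (fun v => lp.single 2 v (1 : ℝ))).sum

lemma inner_multVec {V : Type*} [DecidableEq V] (γ : List V) (f : lp (fun _ : V => ℝ) 2) :
    inner ℝ f (multVec γ) = (γ.map (fun v => f v)).sum := by
  induction γ with
  | nil => simp [multVec]
  | cons a γ ih =>
    simp only [multVec, List.map_cons, List.sum_cons, inner_add_right] at ih ⊢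
    rw [ih, lp.inner_single_right]
    simp

lemma multVec_cons {V : Type*} [DecidableEq V] (a : V) (γ : List V) (v : V) :
    (multVec (a :: γ) : V → ℝ) v = (if v = a then 1 else 0) + (multVec γ : V → ℝ) v := by
  simp only [multVec, List.map_cons, List.sum_cons, lp.coeFn_add, Pi.add_apply]
  congr 1
  simp [lp.single_apply, Pi.single_apply]

lemma multVec_nonneg {V : Type*} [DecidableEq V] (γ : List V) (v : V) :
    0 ≤ (multVec γ : V → ℝ) v := by
  induction γ with
  | nil => simp [multVec]
  | cons a γ ih => rw [multVec_cons]; split_ifs <;> linarith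

lemma multVec_ge {V : Type*} [DecidableEq V] (γ : List V) (v : V) (hv : v ∈ γ) :
    1 ≤ (multVec γ : V → ℝ) v := by
  induction γ with
  | nil => simp at hv
  | cons a γ ih =>
    rw [multVec_cons]
    have := multVec_nonneg γ v
    rcases List.mem_cons.mp hv with h | h
    · simp [h] at *; linarith
    · have := ih h
      split_ifs <;> linarith

lemma ofReal_list_sum {V : Type*} (γ : List V) (f : V → ℝ) :
    ENNReal.ofReal (γ.map f).sum ≤ (γ.map fun v => ENNReal.ofReal (f v)).sum := by
  induction γ with
  | nil => simp
  | cons a γ ih =>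
    simp only [List.map_cons, List.sum_cons]
    exact ENNReal.ofReal_add_le.trans (by gcongr)

lemma tsum_sq_le {V : Type*} (c : lp (fun _ : V => ℝ) 2) :
    ∑' v, (ENNReal.ofReal (c v)) ^ 2 ≤ ENNReal.ofReal (‖c‖ ^ 2) := by
  have h := lp.hasSum_norm (p := 2) (by norm_num) c
  simp only [ENNReal.toReal_ofNat, Real.rpow_two, Real.norm_eq_abs, sq_abs] at h
  rw [← h.tsum_eq, ENNReal.ofReal_tsum_of_nonneg (fun v => sq_nonneg _) h.summable]
  refine ENNReal.tsum_le_tsum fun v => ?_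
  rcases le_total 0 (c v) with h0 | h0
  · rw [ENNReal.ofReal_pow h0]
  · simp [ENNReal.ofReal_of_nonpos h0]

lemma strong {V : Type*} (G : SimpleGraph V) (A B : Set V) :
    MOD {γ | ConnectsSets G A B γ} ≤ (MODsets (CutFamily G A B))⁻¹ := by
  classical
  by_cases hne : ∃ γ, ConnectsSets G A B γ
  swap
  · push Not at hne
    have : MOD {γ | ConnectsSets G A B γ} ≤ 0 := by
      refine (iInf₂_le (fun _ => 0) ?_).trans ?_
      · intro γ hγ; exact absurd hγ (hne γ)
      · simp
    exact this.trans (zero_le)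
  set P : Set (lp (fun _ : V => ℝ) 2) := multVec '' {γ | ConnectsSets G A B γ} with hP
  set C := convexHull ℝ P with hC
  -- every element of `C` is admissible for cuts
  have hCadm : C ⊆ {c | (∀ v, 0 ≤ c v) ∧ ∀ S ∈ CutFamily G A B,
      1 ≤ ∑' v : S, ENNReal.ofReal (c v)} := by
    refine convexHull_min ?_ ?_
    · rintro _ ⟨γ, hγ, rfl⟩
      refine ⟨multVec_nonneg γ, fun S hS => ?_⟩
      obtain ⟨v, hv, hvS⟩ := hS γ hγ
      refine le_trans ?_ (ENNReal.le_tsum (⟨v, hvS⟩ : S))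
      simpa using multVec_ge γ v hv
    · rintro x ⟨hx0, hx⟩ y ⟨hy0, hy⟩ a b ha hb hab
      refine ⟨fun v => ?_, fun S hS => ?_⟩
      · have := hx0 v
        have := hy0 v
        simp only [lp.coeFn_add, lp.coeFn_smul, Pi.add_apply, Pi.smul_apply, smul_eq_mul]
        positivity
      · have e : ∀ v : S, ENNReal.ofReal ((a • x + b • y : lp (fun _ : V => ℝ) 2) v)
            = ENNReal.ofReal a * ENNReal.ofReal (x v) + ENNReal.ofReal b * ENNReal.ofReal (y v) := by
          intro v
          simp only [lp.coeFn_add, lp.coeFn_smul, Pi.add_apply, Pi.smul_apply, smul_eq_mul]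
          rw [ENNReal.ofReal_add (mul_nonneg ha (hx0 v)) (mul_nonneg hb (hy0 v)),
            ENNReal.ofReal_mul ha, ENNReal.ofReal_mul hb]
        simp_rw [e]
        rw [ENNReal.tsum_add, ENNReal.tsum_mul_left, ENNReal.tsum_mul_left]
        calc (1 : ℝ≥0∞) = ENNReal.ofReal a * 1 + ENNReal.ofReal b * 1 := by
              rw [mul_one, mul_one, ← ENNReal.ofReal_add ha hb, hab, ENNReal.ofReal_one]
          _ ≤ _ := by
              gcongr
              · exact hx S hS
              · exact hy S hS
  have hcl : closure C ⊆ {c | MODsets (CutFamily G A B) ≤ ENNReal.ofReal (‖c‖ ^ 2)} := by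
    refine closure_minimal ?_ ?_
    · intro c hc
      have hle : MODsets (CutFamily G A B) ≤ ∑' v, (ENNReal.ofReal (c v)) ^ 2 :=
        iInf₂_le (fun v => ENNReal.ofReal (c v)) (hCadm hc).2
      exact hle.trans (tsum_sq_le c)
    · exact isClosed_le continuous_const (ENNReal.continuous_ofReal.comp (by fun_prop))
  have hconv : Convex ℝ (closure C) := (convex_convexHull ℝ P).closure
  have hnon : (closure C).Nonempty := by
    obtain ⟨γ, hγ⟩ := hne
    exact ⟨multVec γ, subset_closure (subset_convexHull ℝ P ⟨γ, hγ, rfl⟩)⟩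
  obtain ⟨c, hc, hmin⟩ := exists_norm_eq_iInf_of_complete_convex hnon
    isClosed_closure.isComplete hconv 0
  rw [norm_eq_iInf_iff_real_inner_le_zero hconv hc] at hmin
  have hD : ∀ γ, ConnectsSets G A B γ → ‖c‖ ^ 2 ≤ (γ.map (fun v => c v)).sum := by
    intro γ hγ
    have := hmin (multVec γ) (subset_closure (subset_convexHull ℝ P ⟨γ, hγ, rfl⟩))
    rw [zero_sub, inner_neg_left, inner_sub_right, inner_multVec, real_inner_self_eq_norm_sq] at this
    linarith
  have hle : MOD {γ | ConnectsSets G A B γ} ≤ (ENNReal.ofReal (‖c‖ ^ 2))⁻¹ := by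
    by_cases h0 : ‖c‖ = 0
    · simp [h0]
    have hpos : 0 < ‖c‖ ^ 2 := by positivity
    set x : lp (fun _ : V => ℝ) 2 := (‖c‖ ^ 2)⁻¹ • c with hx
    refine (iInf₂_le (fun v => ENNReal.ofReal (x v)) ?_).trans ((tsum_sq_le x).trans ?_)
    · intro γ hγ
      refine le_trans ?_ (ofReal_list_sum γ (fun v => x v))
      rw [ENNReal.one_le_ofReal]
      simp only [hx, lp.coeFn_smul, Pi.smul_apply, smul_eq_mul]
      rw [List.sum_map_mul_left]
      have := hD γ hγ
      calc (1 : ℝ) = (‖c‖ ^ 2)⁻¹ * ‖c‖ ^ 2 := by field_simp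
        _ ≤ _ := by gcongr
    · rw [← ENNReal.ofReal_inv_of_pos hpos]
      apply ENNReal.ofReal_le_ofReal
      rw [hx, norm_smul, norm_inv, norm_pow, norm_norm]
      apply le_of_eq
      field_simp
  exact hle.trans (ENNReal.inv_le_inv.mpr (hcl hc))

/-- Duality: `VEL(Γ*(V₁,V₂)) = VEL(Γ(V₁,V₂))⁻¹` for disjoint nonempty vertex
sets `V₁`, `V₂`. -/
theorem stmt8 {V : Type*} (G : SimpleGraph V) (A B : Set V)
    (hA : A.Nonempty) (hB : B.Nonempty) (hAB : Disjoint A B) :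
    VELsets (CutFamily G A B) = (VELbetween G A B)⁻¹ := by
  have e : (VELbetween G A B)⁻¹ = MOD {γ | ConnectsSets G A B γ} := by
    simp [VELbetween, VEL]
  rw [e]
  refine le_antisymm ?_ (strong G A B)
  refine le_iInf₂ fun m hm => ?_
  rw [VELsets, ENNReal.inv_le_iff_inv_le]
  exact le_iInf₂ fun n hn => weak G A B m n hm hn
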